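/- Let λ0 ≥ λ1 ≥ ... ≥ λ_{2m+1} be real numbers and let a1 ≥ a2 ≥ ... ≥ a_m and a0 be nonnegative real numbers satisfying: (1) a_i ≥ λ_{2i−1} for i = 1, ..., m; (2) Σ_{i=0}^{k} λ_i ≥ Σ_{i=1}^{⌈(k+1)/2⌉} a_i + Σ_{i=1}^{⌊(k+1)/2⌋} a_i for k = 1, ..., 2m−1; and (3) Σ_{i=0}^{2m+1} λ_i = 2·Σ_{i=0}^{m} a_i. Then there exists a (2m+2)×(2m+2) nonnegative bisymmetric real matrix whose eigenvalues (with multiplicity) are λ0, λ1, ..., λ_{2m+1} and whose diagonal entries are, in order, a_m, a_{m−1}, ..., a1, a0, a0, a1, ..., a_{m−1}, a_m. -/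

import Mathlib

open Matrix Polynomial BigOperators

/-- The `n × n` reverse identity (exchange) matrix `J`, with entry `1` in
positions `(i, j)` with `i + j = n - 1` (0-based) and `0` elsewhere. -/
def revId (n : ℕ) : Matrix (Fin n) (Fin n) ℝ :=
  Matrix.of fun i j => if (i : ℕ) + (j : ℕ) + 1 = n then 1 else 0

/-- A square real matrix `Q` is bisymmetric if `Qᵀ = Q` and `JQJ = Q`. -/
def IsBisymm {n : ℕ} (Q : Matrix (Fin n) (Fin n) ℝ) : Prop :=
  Qᵀ = Q ∧ revId n * Q * revId n = Q

/-- Entrywise nonnegative matrix. -/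
def MatNonneg {n : ℕ} (Q : Matrix (Fin n) (Fin n) ℝ) : Prop :=
  ∀ i j, 0 ≤ Q i j

/-- Entrywise positive matrix. -/
def MatPos {n : ℕ} (Q : Matrix (Fin n) (Fin n) ℝ) : Prop :=
  ∀ i j, 0 < Q i j

/-- `lam 0, …, lam (n-1)` are the eigenvalues of `Q` with multiplicity, i.e. the
characteristic polynomial of `Q` is `∏ i (X - lam i)`. -/
def HasEigs {n : ℕ} (Q : Matrix (Fin n) (Fin n) ℝ) (lam : Fin n → ℝ) : Prop :=
  Q.charpoly = ∏ i, (X - Polynomial.C (lam i))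

/-- The multiset `μ` is the multiset of eigenvalues (with multiplicity) of `Q`. -/
def HasEigsM {n : ℕ} (Q : Matrix (Fin n) (Fin n) ℝ) (μ : Multiset ℝ) : Prop :=
  Q.charpoly = (μ.map fun a => X - Polynomial.C a).prod

/-- `r` is the Perron root of `Q`: it is a (real) eigenvalue of `Q` which equals the
spectral radius of `Q`, i.e. every complex eigenvalue of `Q` has modulus at most `r`. -/
def IsPerronRoot {n : ℕ} (Q : Matrix (Fin n) (Fin n) ℝ) (r : ℝ) : Prop :=
  r ∈ spectrum ℝ Q ∧ ∀ μ ∈ spectrum ℂ (Q.map fun a => (a : ℂ)), ‖μ‖ ≤ r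

/-- Fiedler-type lemma: symmetric matrix with nonnegative off-diagonal entries, prescribed diagonal
and prescribed orthonormal eigen-decomposition whose first eigenvector is nonnegative. -/
theorem fiedler_aux (m : ℕ) : ∀ (mu d : ℕ → ℝ)
    (_ : ∀ i, i < m → mu (i + 1) ≤ d i)
    (_ : ∀ k, k < m → ∑ i ∈ Finset.range (k + 1), d i ≤ ∑ i ∈ Finset.range (k + 1), mu i)
    (_ : ∑ i ∈ Finset.range (m + 1), mu i = ∑ i ∈ Finset.range (m + 1), d i),
    ∃ S U : Matrix (Fin (m + 1)) (Fin (m + 1)) ℝ,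
      (∀ i j, S i j = S j i) ∧ (∀ i, S i i = d i) ∧ (∀ i j, i ≠ j → 0 ≤ S i j) ∧
      (∀ j k, ∑ i, U i j * U i k = if j = k then 1 else 0) ∧
      (∀ i k, ∑ j, S i j * U j k = mu k * U i k) ∧ (∀ i, 0 ≤ U i 0) := by
  induction m with
  | zero =>
    intro mu d _ _ h
    refine ⟨fun _ _ => d 0, fun _ _ => 1, ?_, ?_, ?_, ?_, ?_, ?_⟩
    · intros; rfl
    · intro i; fin_cases i; rfl
    · intro i j hij; exact absurd (Fin.ext (by omega)) hij
    · intro j k; have h : j = k := Fin.ext (by omega)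
      simp [h]
    · intro i k; fin_cases k; simpa using h.symm
    · intro i; norm_num
  | succ m ih =>
    intro mu d hd hs he
    obtain ⟨x, y, hx, hy, hxy, hp⟩ : ∃ x y : ℝ, 0 ≤ x ∧ 0 ≤ y ∧ x ^ 2 + y ^ 2 = 1 ∧
        d 0 = mu 0 * x ^ 2 + mu 1 * y ^ 2 := by
      have h0 : d 0 ≤ mu 0 := by simpa using hs 0 (by omega)
      have h1 : mu 1 ≤ d 0 := hd 0 (by omega)
      obtain ⟨t, ht0, ht1, ht⟩ : ∃ t : ℝ, 0 ≤ t ∧ t ≤ 1 ∧ d 0 = mu 0 * t + mu 1 * (1 - t) := by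
        rcases eq_or_lt_of_le (h1.trans h0) with h | h
        · exact ⟨1, by norm_num, le_rfl, by linarith⟩
        · have h' : 0 < mu 0 - mu 1 := by linarith
          refine ⟨(d 0 - mu 1) / (mu 0 - mu 1), div_nonneg (by linarith) h'.le, ?_, ?_⟩
          · rw [div_le_one h']; linarith
          · field_simp; ring
      refine ⟨√t, √(1 - t), Real.sqrt_nonneg _, Real.sqrt_nonneg _, ?_, ?_⟩
      · rw [Real.sq_sqrt ht0, Real.sq_sqrt (by linarith)]; ring
      · rw [Real.sq_sqrt ht0, Real.sq_sqrt (by linarith)]; exact ht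
    have h10 : mu 1 ≤ mu 0 :=
      (hd 0 (by omega)).trans (by simpa using hs 0 (by omega))
    have hsum : ∀ k, ∑ i ∈ Finset.range (k + 1),
        (fun i => if i = 0 then mu 0 + mu 1 - d 0 else mu (i + 1)) i
        = ∑ i ∈ Finset.range (k + 2), mu i - d 0 := by
      intro k
      rw [Finset.sum_range_succ', Finset.sum_range_succ' _ (k + 1), Finset.sum_range_succ' _ k]
      simp
      ring
    obtain ⟨S, U, hS, hSd, hSn, hO, hE, hU⟩ :=
      ih (fun i => if i = 0 then mu 0 + mu 1 - d 0 else mu (i + 1)) (fun i => d (i + 1))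
        (by intro i hi; simpa using hd (i + 1) (by omega))
        (by
          intro k hk
          rw [hsum]
          have := hs (k + 1) (by omega)
          rw [Finset.sum_range_succ' d] at this
          linarith)
        (by
          rw [hsum, he, Finset.sum_range_succ' d]; ring)
    set r : ℝ := (mu 0 - mu 1) * x * y with hr
    have hr0 : 0 ≤ r := by
      have : 0 ≤ mu 0 - mu 1 := by linarith
      positivity
    have hb : mu 0 + mu 1 - d 0 = mu 0 * y ^ 2 + mu 1 * x ^ 2 := by
      have : x ^ 2 = 1 - y ^ 2 := by linarith
      rw [hp, this]; ring
    have hE0 : ∀ i, ∑ j, S i j * U j 0 = (mu 0 * y ^ 2 + mu 1 * x ^ 2) * U i 0 := by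
      intro i; rw [hE i 0]; simp [hb]
    have hEs : ∀ i (k : Fin m), ∑ j, S i j * U j k.succ = mu (k + 2) * U i k.succ := by
      intro i k; rw [hE i k.succ]; simp
    have hO00 : ∑ i, U i 0 * U i 0 = 1 := by simpa using hO 0 0
    have hO0s : ∀ k : Fin m, ∑ i, U i 0 * U i k.succ = 0 := by
      intro k; simpa [(Fin.succ_ne_zero k).symm] using hO 0 k.succ
    have hOs0 : ∀ k : Fin m, ∑ i, U i k.succ * U i 0 = 0 := by
      intro k; simpa using hO k.succ 0
    have hOss : ∀ j k : Fin m, ∑ i, U i j.succ * U i k.succ = if j = k then 1 else 0 := by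
      intro j k; simpa using hO j.succ k.succ
    refine ⟨Fin.cons (Fin.cons (d 0) (fun j => r * U j 0))
        (fun i => Fin.cons (r * U i 0) (fun j => S i j)),
      Fin.cons (Fin.cons x (Fin.cons (-y) (fun _ => 0)))
        (fun i => Fin.cons (y * U i 0) (Fin.cons (x * U i 0) (fun j => U i j.succ))),
      ?_, ?_, ?_, ?_, ?_, ?_⟩
    · intro i j
      refine Fin.cases ?_ (fun i => ?_) i <;> refine Fin.cases ?_ (fun j => ?_) j <;> simp
      exact hS i j
    · intro i
      refine Fin.cases ?_ (fun i => ?_) i <;> simp [hSd]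
    · intro i j
      refine Fin.cases ?_ (fun i => ?_) i <;> refine Fin.cases ?_ (fun j => ?_) j
      · simp
      · intro _; simpa using mul_nonneg hr0 (hU j)
      · intro _; simpa using mul_nonneg hr0 (hU i)
      · intro h; simpa using hSn i j (fun h' => h (by rw [h']))
    · have key : ∀ (p q : ℝ) (f g : Fin (m + 1) → ℝ),
          ∑ i, (p * f i) * (q * g i) = p * q * ∑ i, f i * g i := by
        intro p q f g; rw [Finset.mul_sum]; exact Finset.sum_congr rfl fun i _ => by ring
      have key2 : ∀ (q : ℝ) (f g : Fin (m + 1) → ℝ),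
          ∑ i, f i * (q * g i) = q * ∑ i, f i * g i := by
        intro q f g; rw [Finset.mul_sum]; exact Finset.sum_congr rfl fun i _ => by ring
      have key3 : ∀ (q : ℝ) (f g : Fin (m + 1) → ℝ),
          ∑ i, (q * f i) * g i = q * ∑ i, f i * g i := by
        intro q f g; rw [Finset.mul_sum]; exact Finset.sum_congr rfl fun i _ => by ring
      intro j k
      rw [Fin.sum_univ_succ]
      refine Fin.cases ?_ (fun j => Fin.cases ?_ (fun j => ?_) j) j <;>
        refine Fin.cases ?_ (fun k => Fin.cases ?_ (fun k => ?_) k) k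
      · simp only [Fin.cons_zero, Fin.cons_succ, key, hO00]; simp; linarith
      · simp only [Fin.cons_zero, Fin.cons_succ, key, hO00]; simp; ring
      · simp only [Fin.cons_zero, Fin.cons_succ, key3, hO0s]
        simp [(Fin.succ_ne_zero _).symm]
      · simp only [Fin.cons_zero, Fin.cons_succ, key, hO00]; simp; ring
      · simp only [Fin.cons_zero, Fin.cons_succ, key, hO00]; simp; linarith
      · simp only [Fin.cons_zero, Fin.cons_succ, key3, hO0s]
        simp [Fin.ext_iff]
      · simp only [Fin.cons_zero, Fin.cons_succ, key2, hOs0]; simp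
      · simp only [Fin.cons_zero, Fin.cons_succ, key2, hOs0]; simp [Fin.ext_iff]
      · simp only [Fin.cons_zero, Fin.cons_succ, hOss]; simp
    · have key : ∀ (p q : ℝ) (f g : Fin (m + 1) → ℝ),
          ∑ i, (p * f i) * (q * g i) = p * q * ∑ i, f i * g i := by
        intro p q f g; rw [Finset.mul_sum]; exact Finset.sum_congr rfl fun i _ => by ring
      have key2 : ∀ (q : ℝ) (f g : Fin (m + 1) → ℝ),
          ∑ i, f i * (q * g i) = q * ∑ i, f i * g i := by
        intro q f g; rw [Finset.mul_sum]; exact Finset.sum_congr rfl fun i _ => by ring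
      have key3 : ∀ (q : ℝ) (f g : Fin (m + 1) → ℝ),
          ∑ i, (q * f i) * g i = q * ∑ i, f i * g i := by
        intro q f g; rw [Finset.mul_sum]; exact Finset.sum_congr rfl fun i _ => by ring
      have hx2 : x ^ 2 = 1 - y ^ 2 := by linarith
      intro i k
      rw [Fin.sum_univ_succ]
      refine Fin.cases ?_ (fun i => ?_) i <;>
        refine Fin.cases ?_ (fun k => Fin.cases ?_ (fun k => ?_) k) k
      · simp only [Fin.cons_zero, Fin.cons_succ, key, hO00, hp, hr]; simp
        linear_combination (mu 0 * x) * hxy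
      · simp only [Fin.cons_zero, Fin.cons_succ, key, hO00, hp, hr]; simp
        linear_combination (-mu 1 * y) * hxy
      · simp only [Fin.cons_zero, Fin.cons_succ, key3, hO0s]; simp
      · simp only [Fin.cons_zero, Fin.cons_succ, key2, hE0, hr]; simp
        linear_combination (mu 0 * y * U i 0) * hxy
      · simp only [Fin.cons_zero, Fin.cons_succ, key2, hE0, hr]; simp
        linear_combination (mu 1 * x * U i 0) * hxy
      · simp only [Fin.cons_zero, Fin.cons_succ, hEs]; simp
    · intro i
      refine Fin.cases ?_ (fun i => ?_) i
      · simpa using hx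
      · simpa using mul_nonneg hy (hU i)

theorem charpoly_of_eig {n : ℕ} (S U : Matrix (Fin n) (Fin n) ℝ) (mu : Fin n → ℝ)
    (hO : ∀ j k, ∑ i, U i j * U i k = if j = k then 1 else 0)
    (hE : ∀ i k, ∑ j, S i j * U j k = mu k * U i k) :
    S.charpoly = ∏ i, (X - Polynomial.C (mu i)) := by
  have h1 : Uᵀ * U = 1 := by
    ext j k; simp [Matrix.mul_apply, hO, Matrix.one_apply]
  have h2 : U * Uᵀ = 1 := mul_eq_one_comm.mp h1
  have h3 : S * U = U * Matrix.diagonal mu := by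
    ext i k; rw [Matrix.mul_diagonal, Matrix.mul_apply, hE, mul_comm]
  have h4 : S = U * (Matrix.diagonal mu * Uᵀ) := by
    rw [← Matrix.mul_assoc, ← h3, Matrix.mul_assoc, h2, Matrix.mul_one]
  rw [h4, Matrix.charpoly_mul_comm, Matrix.mul_assoc, h1, Matrix.mul_one]
  exact Matrix.charpoly_diagonal mu

theorem charpoly_blocks {n : Type*} [Fintype n] [DecidableEq n] (A B : Matrix n n ℝ) :
    (Matrix.fromBlocks A B B A).charpoly = (A + B).charpoly * (A - B).charpoly := by
  have h : Matrix.fromBlocks A B B A =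
      Matrix.fromBlocks 1 0 1 1 * (Matrix.fromBlocks (A + B) B 0 (A - B) *
        Matrix.fromBlocks 1 0 (-1) 1) := by
    simp [Matrix.fromBlocks_multiply]
  rw [h, Matrix.charpoly_mul_comm, Matrix.mul_assoc, Matrix.fromBlocks_multiply
    (1 : Matrix n n ℝ) 0 (-1) 1]
  simp [Matrix.charpoly_fromBlocks_zero₂₁]

theorem prod_even_odd {M : Type*} [CommMonoid M] (f : ℕ → M) (m : ℕ) :
    (∏ j : Fin (m + 1), f (2 * j)) * (∏ j : Fin (m + 1), f (2 * j + 1)) =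
      ∏ i : Fin (2 * m + 2), f i := by
  rw [Fin.prod_univ_eq_prod_range (fun j => f (2 * j)),
    Fin.prod_univ_eq_prod_range (fun j => f (2 * j + 1)), Fin.prod_univ_eq_prod_range f]
  induction m with
  | zero => simp [Finset.prod_range_succ]
  | succ m ih =>
    rw [Finset.prod_range_succ, Finset.prod_range_succ (fun j => f (2 * j + 1)),
      show 2 * (m + 1) + 2 = 2 * m + 2 + 1 + 1 by ring, Finset.prod_range_succ f,
      Finset.prod_range_succ f, ← ih, show 2 * (m + 1) = 2 * m + 2 by ring]
    exact mul_mul_mul_comm _ _ _ _ |>.trans (mul_assoc _ _ _).symm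

theorem sum_even_odd (f : ℕ → ℝ) (m : ℕ) :
    ∑ i ∈ Finset.range (2 * m), f i =
    (∑ j ∈ Finset.range m, f (2 * j)) + (∑ j ∈ Finset.range m, f (2 * j + 1)) := by
  induction m with
  | zero => simp
  | succ m ih =>
    rw [Finset.sum_range_succ, Finset.sum_range_succ (fun j => f (2 * j + 1)),
      show 2 * (m + 1) = 2 * m + 1 + 1 by ring, Finset.sum_range_succ f,
      Finset.sum_range_succ f, ih]
    ring

theorem sum_Icc_one_aux (f : ℕ → ℝ) (m : ℕ) :
    ∑ i ∈ Finset.Icc 1 m, f i = ∑ j ∈ Finset.range m, f (j + 1) := by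
  rw [Finset.range_eq_Ico, Finset.sum_Ico_add' f 0 m 1]
  rfl

/-- the index in `Fin (m+1)` of the pair containing position `i` -/
def pairIdx (m : ℕ) (i : Fin (2 * m + 2)) : Fin (m + 1) :=
  if h : (i : ℕ) ≤ m then (if i = (m : ℕ) then ⟨m, by omega⟩ else ⟨m - i - 1, by omega⟩)
  else (if (i : ℕ) = m + 1 then ⟨m, by omega⟩ else ⟨i - m - 2, by omega⟩)

/-- position to block index -/
def blockIdx (m : ℕ) (i : Fin (2 * m + 2)) : Fin (m + 1) ⊕ Fin (m + 1) :=
  if (i : ℕ) ≤ m then Sum.inl (pairIdx m i) else Sum.inr (pairIdx m i)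

theorem blockIdx_bij (m : ℕ) : Function.Bijective (blockIdx m) := by
  rw [Fintype.bijective_iff_injective_and_card]
  constructor
  · intro i j h
    have hi := i.2
    have hj := j.2
    ext
    unfold blockIdx pairIdx at h
    split_ifs at h <;> simp only [Sum.inl.injEq, Sum.inr.injEq, Fin.mk.injEq, reduceCtorEq] at h <;> omega
  · simp; ring

theorem blockIdx_rev (m : ℕ) (i : Fin (2 * m + 2)) : blockIdx m i.rev = (blockIdx m i).swap := by
  have hi := i.2
  unfold blockIdx pairIdx
  simp only [Fin.val_rev]
  split_ifs <;> first | omega | (simp; done) | (simp; omega)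

theorem revId_mul_mul (n : ℕ) (Q : Matrix (Fin n) (Fin n) ℝ) :
    revId n * Q * revId n = Q.submatrix Fin.rev Fin.rev := by
  have hl : ∀ i j : Fin n, revId n i j = if j = i.rev then 1 else 0 := by
    intro i j
    simp only [revId, Matrix.of_apply, Fin.ext_iff, Fin.val_rev]
    congr 1
    have := i.2
    have := j.2
    apply propext; constructor <;> intro <;> omega
  have hr : ∀ i j : Fin n, revId n i j = if i = j.rev then 1 else 0 := by
    intro i j
    rw [hl]
    congr 1
    apply propext
    constructor <;> rintro rfl <;> simp
  ext i j
  rw [Matrix.mul_apply]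
  simp only [hr _ j, mul_ite, mul_one, mul_zero, Finset.sum_ite_eq', Finset.mem_univ, if_true]
  rw [Matrix.mul_apply]
  simp [hl i]

/-- Theorem 5.3: BNIEP with prescribed diagonal, even size. Under conditions (1)–(3)
there is a `(2m+2) × (2m+2)` nonnegative bisymmetric matrix with eigenvalues
`λ₀, …, λ_{2m+1}` and diagonal `a_m, a_{m-1}, …, a₁, a₀, a₀, a₁, …, a_{m-1}, a_m`. -/
theorem bniep_diag_even (m : ℕ) (lam : ℕ → ℝ) (a : ℕ → ℝ)
    (hanti : ∀ i j, i ≤ j → j ≤ 2 * m + 1 → lam j ≤ lam i)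
    (hamono : ∀ i j, 1 ≤ i → i ≤ j → j ≤ m → a j ≤ a i)
    (hann : ∀ i, i ≤ m → 0 ≤ a i)
    (h1 : ∀ i, 1 ≤ i → i ≤ m → lam (2 * i - 1) ≤ a i)
    (h2 : ∀ k, 1 ≤ k → k ≤ 2 * m - 1 →
        (∑ i ∈ Finset.Icc 1 ((k + 2) / 2), a i) + (∑ i ∈ Finset.Icc 1 ((k + 1) / 2), a i)
          ≤ ∑ i ∈ Finset.range (k + 1), lam i)
    (h3 : ∑ i ∈ Finset.range (2 * m + 2), lam i = 2 * ∑ i ∈ Finset.range (m + 1), a i) :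
    ∃ Q : Matrix (Fin (2 * m + 2)) (Fin (2 * m + 2)) ℝ,
      MatNonneg Q ∧ IsBisymm Q ∧ (HasEigs Q fun i => lam (i : ℕ)) ∧
        ∀ i : Fin (2 * m + 2),
          Q i i = a (if (i : ℕ) ≤ m then m - (i : ℕ) else (i : ℕ) - m - 1) := by
  have hb0 : lam (2 * m) + lam (2 * m + 1) ≤ 2 * a 0 := by
    rw [Finset.sum_range_succ, Finset.sum_range_succ, Finset.sum_range_succ'] at h3
    rcases Nat.eq_zero_or_pos m with rfl | hm
    · simp at h3 ⊢; linarith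
    · have h := h2 (2 * m - 1) (by omega) le_rfl
      rw [show (2 * m - 1 + 2) / 2 = m by omega, show (2 * m - 1 + 1) / 2 = m by omega,
        show 2 * m - 1 + 1 = 2 * m by omega, sum_Icc_one_aux] at h
      linarith
  have hb1 : lam (2 * m + 1) ≤ a 0 := by
    have := hanti (2 * m) (2 * m + 1) (by omega) le_rfl
    linarith
  obtain ⟨b, hblt, hbm⟩ : ∃ b : ℕ → ℝ, (∀ j, j < m → b j = a (j + 1)) ∧ b m = a 0 :=
    ⟨fun j => if j < m then a (j + 1) else a 0, fun j hj => by simp [hj], by simp⟩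
  have hbl : ∀ j, j ≤ m → lam (2 * j + 1) ≤ b j := by
    intro j hj
    rcases eq_or_lt_of_le hj with rfl | hj
    · rw [hbm]; exact hb1
    · rw [hblt j hj]; exact h1 (j + 1) (by omega) (by omega)
  have hbn : ∀ j, j ≤ m → 0 ≤ b j := by
    intro j hj
    rcases eq_or_lt_of_le hj with rfl | hj
    · rw [hbm]; exact hann 0 (by omega)
    · rw [hblt j hj]; exact hann _ (by omega)
  have hbs : ∀ k, k ≤ m → ∑ j ∈ Finset.range k, b j = ∑ j ∈ Finset.range k, a (j + 1) := by
    intro k hk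
    exact Finset.sum_congr rfl fun j hj => hblt j (by have := Finset.mem_range.mp hj; omega)
  obtain ⟨S, U, hS, hSd, hSn, hO, hE, -⟩ :=
    fiedler_aux m (fun j => lam (2 * j)) (fun j => 2 * b j - lam (2 * j + 1))
      (by
        intro i hi
        have h := hbl i hi.le
        have h' := hanti (2 * i + 1) (2 * (i + 1)) (by omega) (by omega)
        linarith)
      (by
        intro k hk
        have h := h2 (2 * k + 1) (by omega) (by omega)
        rw [show (2 * k + 1 + 2) / 2 = k + 1 by omega, show (2 * k + 1 + 1) / 2 = k + 1 by omega,
          show 2 * k + 1 + 1 = 2 * (k + 1) by omega, sum_Icc_one_aux, sum_even_odd,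
          ← hbs _ (by omega)] at h
        rw [Finset.sum_sub_distrib, ← Finset.mul_sum]
        linarith)
      (by
        rw [show 2 * m + 2 = 2 * (m + 1) by ring, sum_even_odd, Finset.sum_range_succ' a,
          ← hbs m le_rfl, ← hbm, ← Finset.sum_range_succ b] at h3
        rw [Finset.sum_sub_distrib, ← Finset.mul_sum]
        linarith)
  have hSc := charpoly_of_eig S U (fun k => lam (2 * k)) hO hE
  set T : Matrix (Fin (m + 1)) (Fin (m + 1)) ℝ := Matrix.diagonal fun j => lam (2 * j + 1) with hT
  set A : Matrix (Fin (m + 1)) (Fin (m + 1)) ℝ := (1 / 2 : ℝ) • (S + T) with hA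
  set B : Matrix (Fin (m + 1)) (Fin (m + 1)) ℝ := (1 / 2 : ℝ) • (S - T) with hB
  have hAB : A + B = S := by
    ext i j; simp [hA, hB]; ring
  have hAB' : A - B = T := by
    ext i j; simp [hA, hB]; ring
  have hAd : ∀ j, A j j = b j := by
    intro j; simp [hA, hT, hSd]; ring
  have hBd : ∀ j, B j j = b j - lam (2 * j + 1) := by
    intro j; simp [hB, hT, hSd]; ring
  have hAo : ∀ i j, i ≠ j → A i j = S i j / 2 := by
    intro i j h; simp [hA, hT, Matrix.diagonal_apply_ne _ h]; ring
  have hBo : ∀ i j, i ≠ j → B i j = S i j / 2 := by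
    intro i j h; simp [hB, hT, Matrix.diagonal_apply_ne _ h]; ring
  have hAn : ∀ i j, 0 ≤ A i j := by
    intro i j
    by_cases h : i = j
    · subst h; rw [hAd]; exact hbn _ (by omega)
    · rw [hAo i j h]; have := hSn i j h; positivity
  have hBn : ∀ i j, 0 ≤ B i j := by
    intro i j
    by_cases h : i = j
    · subst h; rw [hBd]; have := hbl i (by omega); linarith
    · rw [hBo i j h]; have := hSn i j h; positivity
  have hSt : Sᵀ = S := by ext i j; exact hS j i
  have hAt : Aᵀ = A := by simp [hA, hSt, hT]
  have hBt : Bᵀ = B := by simp [hB, hSt, hT]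
  let e : Fin (2 * m + 2) ≃ Fin (m + 1) ⊕ Fin (m + 1) := Equiv.ofBijective _ (blockIdx_bij m)
  refine ⟨(Matrix.fromBlocks A B B A).submatrix (blockIdx m) (blockIdx m), ?_, ⟨?_, ?_⟩, ?_, ?_⟩
  · intro i j
    rw [Matrix.submatrix_apply]
    rcases blockIdx m i with x | x <;> rcases blockIdx m j with y | y <;> simp [hAn, hBn]
  · rw [Matrix.transpose_submatrix, Matrix.fromBlocks_transpose, hAt, hBt]
  · rw [revId_mul_mul]
    ext i j
    simp only [Matrix.submatrix_apply, blockIdx_rev]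
    rcases blockIdx m i with x | x <;> rcases blockIdx m j with y | y <;> simp
  · unfold HasEigs
    have h := Matrix.charpoly_reindex e.symm (Matrix.fromBlocks A B B A)
    rw [Matrix.reindex_apply, charpoly_blocks, hAB, hAB', hSc, hT, Matrix.charpoly_diagonal,
      prod_even_odd (fun k => X - Polynomial.C (lam k))] at h
    exact h
  · intro i
    have hi : (Matrix.fromBlocks A B B A).submatrix (blockIdx m) (blockIdx m) i i
        = b (pairIdx m i) := by
      rw [Matrix.submatrix_apply]
      unfold blockIdx
      split_ifs <;> simp [hAd]
    rw [hi]
    have hi2 := i.2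
    unfold pairIdx
    split_ifs with h1 h2 h2
    · simp [hbm, h2]
    · rw [hblt _ (by simp only; omega)]; congr 1; simp only; omega
    · simp [hbm, h2]
    · rw [hblt _ (by simp only; omega)]; congr 1; simp only; omega
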